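/- arXiv:math/0312152 — 3 statements merged into one kernel-verified Lean document; each statement's English description precedes it below -/
import Mathlib

section
/- Let Λ be a finitely aligned k-graph, and let {t_λ : λ ∈ Λ} be a collection of elements of a C*-algebra satisfying (TCK1), (TCK2) and (TCK3) with t_v ≠ 0 for every vertex v. If v is a vertex and E ⊆ vΛ \ Λ⁰ is a finite set with ∏_{λ∈E}(t_v − t_λt_λ*) = 0, then E is exhaustive. -/
open scoped ENNReal

attribute [local instance] Classical.propDecidable

/-- Product of `f` over a set `S`, in some arbitrary order (junk value `1` if `S` is
infinite).  Used for products of commuting projections. -/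
noncomputable def listProd {ι A : Type*} [Monoid A] (S : Set ι) (f : ι → A) : A :=
  if h : S.Finite then (h.toFinset.toList.map f).prod else 1

/-- A `k`-graph: a countable category `Λ` (whose morphisms are the terms of `Path`, with
vertices identified with the morphisms of degree `0`) together with a degree functor
`d : Λ → ℕ^k` satisfying the factorisation property. -/
structure KGraph (k : ℕ) where
  Path : Type
  countable : Countable Path
  d : Path → Fin k → ℕ
  r : Path → Path
  s : Path → Path
  comp : Path → Path → Path
  d_r : ∀ lam, d (r lam) = 0
  d_s : ∀ lam, d (s lam) = 0
  r_r : ∀ lam, r (r lam) = r lam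
  s_r : ∀ lam, s (r lam) = r lam
  r_s : ∀ lam, r (s lam) = s lam
  s_s : ∀ lam, s (s lam) = s lam
  comp_source : ∀ lam, comp lam (s lam) = lam
  range_comp : ∀ lam, comp (r lam) lam = lam
  r_comp : ∀ lam mu, s lam = r mu → r (comp lam mu) = r lam
  s_comp : ∀ lam mu, s lam = r mu → s (comp lam mu) = s mu
  d_comp : ∀ lam mu, s lam = r mu → d (comp lam mu) = d lam + d mu
  comp_assoc : ∀ lam mu nu, s lam = r mu → s mu = r nu →
    comp (comp lam mu) nu = comp lam (comp mu nu)
  factor : ∀ lam m n, d lam = m + n →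
    ∃! p : Path × Path, s p.1 = r p.2 ∧ d p.1 = m ∧ d p.2 = n ∧ comp p.1 p.2 = lam

namespace KGraph

variable {k : ℕ} (Λ : KGraph k)

/-- Vertices are identified with the paths of degree `0`. -/
def IsVertex (v : Λ.Path) : Prop := Λ.d v = 0

/-- The unique factorisation of `lam` as a product of a path of degree `m` and the
remaining tail (junk value if `¬ m ≤ d lam`). -/
noncomputable def split (lam : Λ.Path) (m : Fin k → ℕ) : Λ.Path × Λ.Path :=
  if h : m ≤ Λ.d lam then
    (Λ.factor lam m (Λ.d lam - m) (by
      funext i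
      exact (Nat.add_sub_cancel' (h i)).symm)).choose
  else (lam, lam)

/-- The segment `λ(m,n)` of the path `λ`: the unique path of degree `n - m` such that
`λ = λ(0,m) λ(m,n) λ(n, d λ)` (meaningful for `m ≤ n ≤ d λ`). -/
noncomputable def seg (lam : Λ.Path) (m n : Fin k → ℕ) : Λ.Path :=
  (Λ.split (Λ.split lam n).1 m).2

/-- `MCE(μ,ν)`: minimal common extensions of `μ` and `ν`. -/
def MCE (mu nu : Λ.Path) : Set Λ.Path :=
  {lam | Λ.d lam = Λ.d mu ⊔ Λ.d nu ∧ Λ.seg lam 0 (Λ.d mu) = mu ∧ Λ.seg lam 0 (Λ.d nu) = nu}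

/-- `Λ^min(μ,ν) = {(α,β) : μα = νβ ∈ MCE(μ,ν)}`. -/
def Lmin (mu nu : Λ.Path) : Set (Λ.Path × Λ.Path) :=
  {p | Λ.s mu = Λ.r p.1 ∧ Λ.s nu = Λ.r p.2 ∧ Λ.comp mu p.1 = Λ.comp nu p.2 ∧
    Λ.comp mu p.1 ∈ Λ.MCE mu nu}

/-- `Ext(μ;E)`: extensions of `μ` with respect to `E`. -/
def Ext (mu : Λ.Path) (E : Set Λ.Path) : Set Λ.Path :=
  {a | Λ.r a = Λ.s mu ∧ ∃ nu ∈ E, ∃ b, (a, b) ∈ Λ.Lmin mu nu}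

/-- `Λ` is finitely aligned if all the sets `MCE(μ,ν)` are finite. -/
def FinitelyAligned : Prop := ∀ mu nu, (Λ.MCE mu nu).Finite

/-- `E ⊆ vΛ` is exhaustive if `Ext(λ;E) ≠ ∅` for all `λ ∈ vΛ`. -/
def Exhaustive (v : Λ.Path) (E : Set Λ.Path) : Prop :=
  ∀ lam, Λ.r lam = v → (Λ.Ext lam E).Nonempty

/-- `E ∈ vFE(Λ)`: `E ⊆ vΛ \ {v}` is finite and exhaustive (so `r(E) = v`). -/
def FEat (v : Λ.Path) (E : Set Λ.Path) : Prop :=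
  Λ.IsVertex v ∧ (∀ lam ∈ E, Λ.r lam = v ∧ lam ≠ v) ∧ E.Finite ∧ Λ.Exhaustive v E

/-- `FE(Λ)`: the finite exhaustive sets. -/
def FE : Set (Set Λ.Path) := {E | ∃ v, Λ.FEat v E}

/-- `λE = {λμ : μ ∈ E, r(μ) = s(λ)}`. -/
def lamSet (lam : Λ.Path) (E : Set Λ.Path) : Set Λ.Path :=
  {x | ∃ mu ∈ E, Λ.s lam = Λ.r mu ∧ Λ.comp lam mu = x}

/-- `EΛ = {λμ : λ ∈ E, r(μ) = s(λ)}`. -/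
def setLam (E : Set Λ.Path) : Set Λ.Path :=
  {x | ∃ lam ∈ E, ∃ mu, Λ.s lam = Λ.r mu ∧ Λ.comp lam mu = x}

/-- `𝓔 ⊆ FE(Λ)` is satiated if it satisfies (S1)--(S4). -/
def Satiated (𝓔 : Set (Set Λ.Path)) : Prop :=
  𝓔 ⊆ Λ.FE ∧
  (∀ G ∈ 𝓔, ∀ E ∈ Λ.FE, G ⊆ E → E ∈ 𝓔) ∧
  (∀ G ∈ 𝓔, ∀ v, Λ.FEat v G → ∀ mu, Λ.r mu = v → mu ∉ Λ.setLam G → Λ.Ext mu G ∈ 𝓔) ∧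
  (∀ G ∈ 𝓔, ∀ n : Λ.Path → Fin k → ℕ, (∀ lam ∈ G, 0 < n lam ∧ n lam ≤ Λ.d lam) →
    ((fun lam => Λ.seg lam 0 (n lam)) '' G) ∈ 𝓔) ∧
  (∀ G ∈ 𝓔, ∀ G' ⊆ G, ∀ Gl : Λ.Path → Set Λ.Path,
    (∀ lam ∈ G', Gl lam ∈ 𝓔 ∧ Λ.FEat (Λ.s lam) (Gl lam)) →
    ((G \ G') ∪ ⋃ lam ∈ G', Λ.lamSet lam (Gl lam)) ∈ 𝓔)

/-- The satiation `𝓔̄` of `𝓔`: the smallest satiated subset of `FE(Λ)` containing `𝓔`. -/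
def satiation (𝓔 : Set (Set Λ.Path)) : Set (Set Λ.Path) :=
  ⋂₀ {F | 𝓔 ⊆ F ∧ Λ.Satiated F}

/-- `ΠE`: the smallest subset of `Λ` containing `E` which is closed under the operation
`(λ,μ,σ) ↦ λ Ext(μ;{σ})` for `λ,μ,σ ∈ ΠE` with `d(λ) = d(μ)`, `s(λ) = s(μ)`. -/
def PiSet (E : Set Λ.Path) : Set Λ.Path :=
  ⋂₀ {G | E ⊆ G ∧ ∀ lam mu sig, lam ∈ G → mu ∈ G → sig ∈ G →
    Λ.d lam = Λ.d mu → Λ.s lam = Λ.s mu → Λ.lamSet lam (Λ.Ext mu {sig}) ⊆ G}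

/-- `Σ₁(𝓔)`: finite sets `F ⊆ r(E)Λ \ Λ⁰` containing some `E ∈ 𝓔`. -/
def Sig1 (𝓔 : Set (Set Λ.Path)) : Set (Set Λ.Path) :=
  {F | ∃ E ∈ 𝓔, ∃ v, Λ.FEat v E ∧ E ⊆ F ∧ F.Finite ∧
    ∀ lam ∈ F, Λ.r lam = v ∧ ¬ Λ.IsVertex lam}

/-- `Σ₂(𝓔) = {Ext(μ;E) : E ∈ 𝓔, μ ∈ r(E)Λ \ EΛ}`. -/
def Sig2 (𝓔 : Set (Set Λ.Path)) : Set (Set Λ.Path) :=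
  {F | ∃ E ∈ 𝓔, ∃ v, Λ.FEat v E ∧ ∃ mu, Λ.r mu = v ∧ mu ∉ Λ.setLam E ∧ F = Λ.Ext mu E}

/-- `Σ₃(𝓔) = {{λ(0,n_λ) : λ ∈ E} : E ∈ 𝓔, 0 < n_λ ≤ d(λ)}`. -/
def Sig3 (𝓔 : Set (Set Λ.Path)) : Set (Set Λ.Path) :=
  {F | ∃ E ∈ 𝓔, ∃ n : Λ.Path → Fin k → ℕ, (∀ lam ∈ E, 0 < n lam ∧ n lam ≤ Λ.d lam) ∧
    F = (fun lam => Λ.seg lam 0 (n lam)) '' E}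

/-- `Σ₄(𝓔) = {(E \ F) ∪ ⋃_{λ ∈ F} λ F_λ : E ∈ 𝓔, F ⊆ E, F_λ ∈ s(λ)𝓔}`. -/
def Sig4 (𝓔 : Set (Set Λ.Path)) : Set (Set Λ.Path) :=
  {G | ∃ E ∈ 𝓔, ∃ F ⊆ E, ∃ Fl : Λ.Path → Set Λ.Path,
    (∀ lam ∈ F, Fl lam ∈ 𝓔 ∧ Λ.FEat (Λ.s lam) (Fl lam)) ∧
    G = (E \ F) ∪ ⋃ lam ∈ F, Λ.lamSet lam (Fl lam)}

/-- `Σ = Σ₄ ∘ Σ₃ ∘ Σ₂ ∘ Σ₁`. -/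
def SigmaStep (𝓔 : Set (Set Λ.Path)) : Set (Set Λ.Path) :=
  Λ.Sig4 (Λ.Sig3 (Λ.Sig2 (Λ.Sig1 𝓔)))

/-- `Σ^∞(𝓔) = ⋃_{n ≥ 1} Σ^n(𝓔)`. -/
def SigmaInf (𝓔 : Set (Set Λ.Path)) : Set (Set Λ.Path) :=
  ⋃ n : ℕ, (Λ.SigmaStep)^[n + 1] 𝓔

section StarAlgebra

variable {A : Type*} [Ring A] [StarRing A]

/-- The product `∏_{λ ∈ E} (t_v - t_λ t_λ*)` (the factors pairwise commute for any
family satisfying (TCK1)--(TCK3), so the implicit choice of ordering is immaterial). -/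
noncomputable def gapProd (t : Λ.Path → A) (v : Λ.Path) (E : Set Λ.Path) : A :=
  listProd E fun lam => t v - t lam * star (t lam)

/-- Conditions (TCK1)--(TCK3) on a family `{t_λ}`. -/
def TCKFamily (t : Λ.Path → A) : Prop :=
  (∀ v, Λ.IsVertex v → star (t v) = t v ∧ t v * t v = t v) ∧
  (∀ v w, Λ.IsVertex v → Λ.IsVertex w → v ≠ w → t v * t w = 0) ∧
  (∀ lam mu, Λ.s lam = Λ.r mu → t lam * t mu = t (Λ.comp lam mu)) ∧
  (∀ lam mu, star (t lam) * t mu = ∑ᶠ p ∈ Λ.Lmin lam mu, t p.1 * star (t p.2))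

/-- A relative Cuntz-Krieger `(Λ;𝓔)`-family: (TCK1)--(TCK3) together with (CK). -/
def RCKFamily (𝓔 : Set (Set Λ.Path)) (t : Λ.Path → A) : Prop :=
  Λ.TCKFamily t ∧ ∀ E ∈ 𝓔, ∀ v, Λ.FEat v E → Λ.gapProd t v E = 0

/-- `Θ(t)^{ΠE}_{λ,μ} = t_λ (∏_{λν ∈ ΠE, d(ν) > 0} (t_{s(λ)} - t_ν t_ν*)) t_μ*`. -/
noncomputable def Theta (t : Λ.Path → A) (E : Set Λ.Path) (lam mu : Λ.Path) : A :=
  t lam *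
    listProd {nu | Λ.s lam = Λ.r nu ∧ ¬ Λ.IsVertex nu ∧ Λ.comp lam nu ∈ Λ.PiSet E}
      (fun nu => t (Λ.s lam) - t nu * star (t nu)) *
    star (t mu)

end StarAlgebra

end KGraph

/-- A graph morphism `x : Ω_{k,m} → Λ`, encoded by its length `m = d(x) ∈ (ℕ∪{∞})^k`
and its values `x(p,q)` on the morphisms `(p,q)` of `Ω_{k,m}` (with the junk value
`x(0,0)` outside the meaningful domain, so graph morphisms are extensional). -/
structure GMor {k : ℕ} (Λ : KGraph k) where
  len : Fin k → ℕ∞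
  seg : (Fin k → ℕ) → (Fin k → ℕ) → Λ.Path
  d_seg : ∀ p q, p ≤ q → (∀ i, (q i : ℕ∞) ≤ len i) → Λ.d (seg p q) = q - p
  r_seg : ∀ p q, p ≤ q → (∀ i, (q i : ℕ∞) ≤ len i) → Λ.r (seg p q) = seg p p
  s_seg : ∀ p q, p ≤ q → (∀ i, (q i : ℕ∞) ≤ len i) → Λ.s (seg p q) = seg q q
  comp_seg : ∀ p q u, p ≤ q → q ≤ u → (∀ i, (u i : ℕ∞) ≤ len i) →
    Λ.comp (seg p q) (seg q u) = seg p u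
  seg_junk : ∀ p q, ¬ (p ≤ q ∧ ∀ i, (q i : ℕ∞) ≤ len i) → seg p q = seg 0 0

namespace GMor

variable {k : ℕ} {Λ : KGraph k}

/-- The range `r(x) = x(0)` of a graph morphism. -/
def range (x : GMor Λ) : Λ.Path := x.seg 0 0

/-- `y = x|_n^{d(x)}`, the restriction of `x` (defined for `n ≤ d(x)`):
`d(y) = d(x) - n` and `y(p,q) = x(n+p, n+q)`. -/
def IsRestriction (y x : GMor Λ) (n : Fin k → ℕ) : Prop :=
  (∀ i, y.len i = x.len i - (n i : ℕ∞)) ∧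
  ∀ p q, p ≤ q → (∀ i, (q i : ℕ∞) ≤ y.len i) → y.seg p q = x.seg (n + p) (n + q)

/-- `y = λx`, the extension of `x` by `λ ∈ Λ r(x)`: `d(y) = d(λ) + d(x)`,
`y(0, d(λ)) = λ` and `y(d(λ), d(λ)+n) = x(0,n)` for `n ≤ d(x)`. -/
def IsExtension (y : GMor Λ) (lam : Λ.Path) (x : GMor Λ) : Prop :=
  (∀ i, y.len i = (Λ.d lam i : ℕ∞) + x.len i) ∧
  y.seg 0 (Λ.d lam) = lam ∧
  ∀ n : Fin k → ℕ, (∀ i, (n i : ℕ∞) ≤ x.len i) →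
    y.seg (Λ.d lam) (Λ.d lam + n) = x.seg 0 n

/-- `x ∈ FΛ^∞`: `x` has an initial segment belonging to `F`. -/
def HasInit (x : GMor Λ) (F : Set Λ.Path) : Prop :=
  ∃ lam ∈ F, (∀ i, (Λ.d lam i : ℕ∞) ≤ x.len i) ∧ x.seg 0 (Λ.d lam) = lam

/-- `z` restricts to `x` on `Ω_{k, d(x)}`. -/
def Agrees (z x : GMor Λ) : Prop :=
  ∀ p q, p ≤ q → (∀ i, (q i : ℕ∞) ≤ x.len i) → z.seg p q = x.seg p q

/-- `z ∈ MCE(x,y)` for graph morphisms `x, y`. -/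
def IsMCE (z x y : GMor Λ) : Prop :=
  (∀ i, z.len i = max (x.len i) (y.len i)) ∧ z.Agrees x ∧ z.Agrees y

/-- `x` is aperiodic: for distinct `λ, μ ∈ Λ r(x)`, `MCE(λx, μx) = ∅`. -/
def Aperiodic (x : GMor Λ) : Prop :=
  ∀ lam mu : Λ.Path, lam ≠ mu → Λ.s lam = x.range → Λ.s mu = x.range →
    ∀ lx mx : GMor Λ, lx.IsExtension lam x → mx.IsExtension mu x →
      ∀ z : GMor Λ, ¬ z.IsMCE lx mx

end GMor

namespace KGraph

variable {k : ℕ} (Λ : KGraph k)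

/-- `x ∈ ∂(Λ;𝓔)`: an `𝓔`-compatible boundary path. -/
def IsBdry (𝓔 : Set (Set Λ.Path)) (x : GMor Λ) : Prop :=
  ∀ n : Fin k → ℕ, (∀ i, (n i : ℕ∞) ≤ x.len i) →
    ∀ E ∈ 𝓔, Λ.FEat (x.seg n n) E →
      ∃ lam ∈ E, (∀ i, ((n + Λ.d lam) i : ℕ∞) ≤ x.len i) ∧ x.seg n (n + Λ.d lam) = lam

/-- Condition (C): aperiodic `𝓔`-compatible boundary paths out of every vertex, and
avoiding any given `F ∈ vFE(Λ) \ 𝓔`. -/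
def CondC (𝓔 : Set (Set Λ.Path)) : Prop :=
  (∀ v, Λ.IsVertex v → ∃ x : GMor Λ, Λ.IsBdry 𝓔 x ∧ x.range = v ∧ x.Aperiodic) ∧
  (∀ v F, Λ.FEat v F → F ∉ 𝓔 →
    ∃ x : GMor Λ, Λ.IsBdry 𝓔 x ∧ x.range = v ∧ ¬ x.HasInit F ∧ x.Aperiodic)

end KGraph

namespace KGraph

variable {k : ℕ} (Λ : KGraph k)

theorem IsVertex.r_eq {Λ : KGraph k} {a : Λ.Path} (ha : Λ.IsVertex a) : Λ.r a = a := by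
  have h0 : Λ.d a = 0 := ha
  have h := (Λ.factor a 0 0 (by simp [h0])).unique (y₁ := (Λ.r a, a)) (y₂ := (a, Λ.s a))
    ⟨Λ.s_r a, Λ.d_r a, h0, Λ.range_comp a⟩ ⟨(Λ.r_s a).symm, h0, Λ.d_s a, Λ.comp_source a⟩
  exact congrArg Prod.fst h

theorem split_eq {lam : Λ.Path} {m : Fin k → ℕ} {p : Λ.Path × Λ.Path}
    (hs : Λ.s p.1 = Λ.r p.2) (hd : Λ.d p.1 = m) (hc : Λ.comp p.1 p.2 = lam) :
    Λ.split lam m = p := by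
  have hdl : Λ.d lam = m + Λ.d p.2 := by rw [← hc, Λ.d_comp _ _ hs, hd]
  have hm : m ≤ Λ.d lam := by rw [hdl]; exact le_self_add
  have hsub : Λ.d p.2 = Λ.d lam - m := by rw [hdl, add_tsub_cancel_left]
  have hdm : Λ.d lam = m + (Λ.d lam - m) := by rw [← hsub, hdl]
  rw [split, dif_pos hm]
  exact (Λ.factor lam m _ hdm).unique (Λ.factor lam m _ hdm).choose_spec.1 ⟨hs, hd, hsub, hc⟩

theorem seg_zero_d (lam : Λ.Path) : Λ.seg lam 0 (Λ.d lam) = lam := by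
  rw [seg, Λ.split_eq (p := (lam, Λ.s lam)) (Λ.r_s lam).symm rfl (Λ.comp_source lam),
    Λ.split_eq (p := (Λ.r lam, lam)) (Λ.s_r lam) (Λ.d_r lam) (Λ.range_comp lam)]

theorem Lmin_self (lam : Λ.Path) : Λ.Lmin lam lam = {(Λ.s lam, Λ.s lam)} := by
  ext ⟨a, b⟩
  simp only [Lmin, MCE, Set.mem_ofPred_eq, Set.mem_singleton_iff, Prod.mk.injEq, sup_idem]
  constructor
  · rintro ⟨ha, hb, hab, hd, -⟩
    have hda : Λ.IsVertex a := by simpa [IsVertex, Λ.d_comp _ _ ha] using hd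
    have hdb : Λ.IsVertex b := by rw [hab, Λ.d_comp _ _ hb] at hd; simpa [IsVertex] using hd
    exact ⟨hda.r_eq.symm.trans ha.symm, hdb.r_eq.symm.trans hb.symm⟩
  · rintro ⟨rfl, rfl⟩
    simp [Λ.r_s, Λ.comp_source, Λ.seg_zero_d]

section StarAlgebra

variable {Λ} {A : Type*} [Ring A] [StarRing A] {t : Λ.Path → A}

theorem TCKFamily.star_mul_self (ht : Λ.TCKFamily t) (lam : Λ.Path) :
    star (t lam) * t lam = t (Λ.s lam) := by
  obtain ⟨h₁, h₂⟩ := ht.1 (Λ.s lam) (Λ.d_s lam)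
  rw [ht.2.2.2, Λ.Lmin_self, finsum_mem_singleton, h₁, h₂]

theorem TCKFamily.range_mul (ht : Λ.TCKFamily t) (lam : Λ.Path) :
    t (Λ.r lam) * t lam = t lam := by
  rw [ht.2.2.1 _ _ (Λ.s_r lam), Λ.range_comp]

theorem TCKFamily.star_mul_eq_zero (ht : Λ.TCKFamily t) {lam nu : Λ.Path}
    (h : Λ.Lmin lam nu = ∅) : star (t nu) * t lam = 0 := by
  have h' : star (t lam) * t nu = 0 := by rw [ht.2.2.2, h, finsum_mem_empty]
  simpa using congrArg star h'

/-- The gap projection over `E` fixes `t_λ` whenever `λ` has no common extension with any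
element of `E`. -/
theorem TCKFamily.gapProd_mul (ht : Λ.TCKFamily t) {lam : Λ.Path} {E : Set Λ.Path}
    (h : Λ.Ext lam E = ∅) : Λ.gapProd t (Λ.r lam) E * t lam = t lam := by
  have hmin : ∀ nu ∈ E, Λ.Lmin lam nu = ∅ := fun nu hnu =>
    Set.eq_empty_of_forall_notMem fun p hp =>
      (h ▸ (⟨hp.1.symm, nu, hnu, p.2, hp⟩ : p.1 ∈ Λ.Ext lam E) : p.1 ∈ (∅ : Set Λ.Path))
  have key : ∀ l : List Λ.Path, (∀ nu ∈ l, nu ∈ E) →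
      (l.map fun nu => t (Λ.r lam) - t nu * star (t nu)).prod * t lam = t lam := by
    intro l hl
    induction l with
    | nil => simp
    | cons nu l ih =>
      rw [List.map_cons, List.prod_cons, mul_assoc, ih fun x hx => hl x (by simp [hx]),
        sub_mul, mul_assoc, ht.star_mul_eq_zero (hmin nu (hl nu (by simp))), ht.range_mul,
        mul_zero, sub_zero]
  rw [gapProd, listProd]
  split_ifs with hE
  · exact key _ fun nu hnu => by simpa using hnu
  · exact one_mul _

end StarAlgebra

end KGraph

/-- from the proof of Lemma 5.3: for a (TCK1)-(TCK3) family with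
nonzero vertex projections, vanishing of the gap product over a finite
`E ⊆ vΛ \ Λ⁰` forces `E` to be exhaustive. -/
theorem statement11 {k : ℕ} (Λ : KGraph k) (hΛ : Λ.FinitelyAligned)
    {A : Type*} [NormedRing A] [StarRing A] [CStarRing A] [NormedAlgebra ℂ A]
    [CompleteSpace A] [StarModule ℂ A]
    (t : Λ.Path → A) (ht : Λ.TCKFamily t)
    (hnz : ∀ v, Λ.IsVertex v → t v ≠ 0)
    (v : Λ.Path) (hv : Λ.IsVertex v)
    (E : Set Λ.Path) (hEfin : E.Finite)
    (hEsub : ∀ lam ∈ E, Λ.r lam = v ∧ ¬ Λ.IsVertex lam)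
    (hprod : Λ.gapProd t v E = 0) :
    Λ.Exhaustive v E := by
  rintro lam rfl
  by_contra hne
  have h0 : t lam = 0 := by
    rw [← ht.gapProd_mul (Set.not_nonempty_iff_eq_empty.mp hne), hprod, zero_mul]
  exact hnz (Λ.s lam) (Λ.d_s lam) (by rw [← ht.star_mul_self, h0, mul_zero])
end

section
/- Let Λ be a finitely aligned k-graph and let 𝓔 ⊆ FE(Λ). Then Σ^∞(𝓔) = 𝓔̄, the satiation of 𝓔, i.e. the smallest satiated subset of FE(Λ) containing 𝓔. -/
open scoped ENNReal

attribute [local instance] Classical.propDecidable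

namespace KGraph

variable {k : ℕ} {Λ : KGraph k}

/-- `μ` is an initial segment of `τ`. -/
def IsPrefix (Λ : KGraph k) (mu tau : Λ.Path) : Prop :=
  ∃ a, Λ.s mu = Λ.r a ∧ Λ.comp mu a = tau

theorem factor_unique {a b a' b' : Λ.Path} (h : Λ.s a = Λ.r b) (h' : Λ.s a' = Λ.r b')
    (hd : Λ.d a = Λ.d a') (hc : Λ.comp a b = Λ.comp a' b') : a = a' ∧ b = b' := by
  have e := Λ.d_comp a b h
  have e' := Λ.d_comp a' b' h'
  have hb : Λ.d b' = Λ.d b := by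
    rw [← hc, e, hd] at e'
    exact (add_left_cancel e').symm
  have := (Λ.factor (Λ.comp a b) (Λ.d a) (Λ.d b) e).unique
    (y₁ := (a, b)) (y₂ := (a', b')) ⟨h, rfl, rfl, rfl⟩ ⟨h', hd.symm, hb, hc.symm⟩
  simpa using this

theorem IsVertex.range_eq_source {v : Λ.Path} (hv : Λ.IsVertex v) :
    Λ.r v = v ∧ v = Λ.s v :=
  factor_unique (Λ.s_r v) (Λ.r_s v).symm ((Λ.d_r v).trans hv.symm)
    ((Λ.range_comp v).trans (Λ.comp_source v).symm)

theorem IsVertex.range_eq {v : Λ.Path} (hv : Λ.IsVertex v) : Λ.r v = v :=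
  hv.range_eq_source.1

theorem IsVertex.source_eq {v : Λ.Path} (hv : Λ.IsVertex v) : Λ.s v = v :=
  hv.range_eq_source.2.symm

theorem split_spec (lam : Λ.Path) (m : Fin k → ℕ) (h : m ≤ Λ.d lam) :
    Λ.s (Λ.split lam m).1 = Λ.r (Λ.split lam m).2 ∧ Λ.d (Λ.split lam m).1 = m ∧
      Λ.comp (Λ.split lam m).1 (Λ.split lam m).2 = lam := by
  have e : Λ.d lam = m + (Λ.d lam - m) := (add_tsub_cancel_of_le h).symm
  have := (Λ.factor lam m (Λ.d lam - m) e).choose_spec.1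
  simp only [split, dif_pos h]
  exact ⟨this.1, this.2.1, this.2.2.2⟩

theorem split_zero_snd (lam : Λ.Path) : (Λ.split lam 0).2 = lam := by
  obtain ⟨h1, h2, h3⟩ := split_spec lam 0 (fun i => Nat.zero_le _)
  rw [IsVertex.source_eq h2] at h1
  rw [h1, Λ.range_comp] at h3
  exact h3

theorem seg_zero (lam : Λ.Path) (m : Fin k → ℕ) : Λ.seg lam 0 m = (Λ.split lam m).1 :=
  split_zero_snd _

theorem seg_zero_isPrefix {lam : Λ.Path} {m : Fin k → ℕ} (h : m ≤ Λ.d lam) :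
    Λ.IsPrefix (Λ.seg lam 0 m) lam := by
  rw [seg_zero]
  exact ⟨_, (split_spec lam m h).1, (split_spec lam m h).2.2⟩

theorem d_seg_zero {lam : Λ.Path} {m : Fin k → ℕ} (h : m ≤ Λ.d lam) :
    Λ.d (Λ.seg lam 0 m) = m := by
  rw [seg_zero]
  exact (split_spec lam m h).2.1

namespace IsPrefix

theorem refl (lam : Λ.Path) : Λ.IsPrefix lam lam :=
  ⟨Λ.s lam, (Λ.r_s lam).symm, Λ.comp_source lam⟩

theorem comp_right {a b : Λ.Path} (h : Λ.s a = Λ.r b) : Λ.IsPrefix a (Λ.comp a b) :=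
  ⟨b, h, rfl⟩

theorem trans {a b c : Λ.Path} (h : Λ.IsPrefix a b) (h' : Λ.IsPrefix b c) :
    Λ.IsPrefix a c := by
  obtain ⟨x, hx, rfl⟩ := h
  obtain ⟨y, hy, rfl⟩ := h'
  rw [Λ.s_comp _ _ hx] at hy
  exact ⟨Λ.comp x y, by rw [Λ.r_comp _ _ hy, hx], (Λ.comp_assoc _ _ _ hx hy).symm⟩

theorem r_eq {a b : Λ.Path} (h : Λ.IsPrefix a b) : Λ.r a = Λ.r b := by
  obtain ⟨x, hx, rfl⟩ := h
  exact (Λ.r_comp _ _ hx).symm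

theorem d_le {a b : Λ.Path} (h : Λ.IsPrefix a b) : Λ.d a ≤ Λ.d b := by
  obtain ⟨x, hx, rfl⟩ := h
  rw [Λ.d_comp _ _ hx]
  exact le_self_add

theorem eq_of_d_eq {a b c : Λ.Path} (h : Λ.IsPrefix a c) (h' : Λ.IsPrefix b c)
    (hd : Λ.d a = Λ.d b) : a = b := by
  obtain ⟨x, hx, rfl⟩ := h
  obtain ⟨y, hy, e⟩ := h'
  exact (factor_unique hx hy hd e.symm).1

theorem of_d_le {a b c : Λ.Path} (h : Λ.IsPrefix a c) (h' : Λ.IsPrefix b c)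
    (hd : Λ.d a ≤ Λ.d b) : Λ.IsPrefix a b := by
  have hp := seg_zero_isPrefix hd
  rwa [← eq_of_d_eq h (hp.trans h') (d_seg_zero hd).symm] at hp

theorem comp_left {a b c : Λ.Path} (h : Λ.IsPrefix b c) (hab : Λ.s a = Λ.r b) :
    Λ.IsPrefix (Λ.comp a b) (Λ.comp a c) := by
  obtain ⟨x, hx, rfl⟩ := h
  exact ⟨x, by rw [Λ.s_comp _ _ hab, hx], Λ.comp_assoc _ _ _ hab hx⟩

theorem of_comp_left {a b c : Λ.Path} (hab : Λ.s a = Λ.r b) (hac : Λ.s a = Λ.r c)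
    (h : Λ.IsPrefix (Λ.comp a b) (Λ.comp a c)) : Λ.IsPrefix b c := by
  obtain ⟨x, hx, e⟩ := h
  rw [Λ.s_comp _ _ hab] at hx
  rw [Λ.comp_assoc _ _ _ hab hx] at e
  exact ⟨x, hx, (factor_unique (by rw [Λ.r_comp _ _ hx, hab]) hac rfl e).2⟩

end IsPrefix

theorem seg_zero_eq_iff {lam mu : Λ.Path} (h : Λ.d mu ≤ Λ.d lam) :
    Λ.seg lam 0 (Λ.d mu) = mu ↔ Λ.IsPrefix mu lam :=
  ⟨fun e => e ▸ seg_zero_isPrefix h,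
    fun hp => (seg_zero_isPrefix h).eq_of_d_eq hp (d_seg_zero h)⟩

theorem mem_MCE_iff {mu nu lam : Λ.Path} :
    lam ∈ Λ.MCE mu nu ↔
      Λ.d lam = Λ.d mu ⊔ Λ.d nu ∧ Λ.IsPrefix mu lam ∧ Λ.IsPrefix nu lam := by
  refine and_congr_right fun hd => ?_
  rw [seg_zero_eq_iff (hd ▸ le_sup_left), seg_zero_eq_iff (hd ▸ le_sup_right)]

theorem mem_Ext_iff {mu a : Λ.Path} {E : Set Λ.Path} :
    a ∈ Λ.Ext mu E ↔ Λ.s mu = Λ.r a ∧ ∃ nu ∈ E, Λ.comp mu a ∈ Λ.MCE mu nu := by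
  constructor
  · rintro ⟨h, nu, hnu, b, hb⟩
    exact ⟨h.symm, nu, hnu, hb.2.2.2⟩
  · rintro ⟨h, nu, hnu, hm⟩
    obtain ⟨b, hb, e⟩ := (mem_MCE_iff.1 hm).2.2
    exact ⟨h.symm, nu, hnu, b, h, hb, e.symm, hm⟩

theorem exists_MCE_isPrefix {mu nu tau : Λ.Path} (hm : Λ.IsPrefix mu tau)
    (hn : Λ.IsPrefix nu tau) : ∃ lam ∈ Λ.MCE mu nu, Λ.IsPrefix lam tau := by
  have hle : Λ.d mu ⊔ Λ.d nu ≤ Λ.d tau := sup_le hm.d_le hn.d_le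
  have hp := seg_zero_isPrefix hle
  have hd := d_seg_zero hle
  exact ⟨_, mem_MCE_iff.2 ⟨hd, hm.of_d_le hp (le_sup_left.trans_eq hd.symm),
    hn.of_d_le hp (le_sup_right.trans_eq hd.symm)⟩, hp⟩

theorem Ext_nonempty_iff {mu : Λ.Path} {E : Set Λ.Path} :
    (Λ.Ext mu E).Nonempty ↔ ∃ nu ∈ E, ∃ tau, Λ.IsPrefix mu tau ∧ Λ.IsPrefix nu tau := by
  constructor
  · rintro ⟨a, ha⟩
    obtain ⟨_, nu, hnu, hm⟩ := mem_Ext_iff.1 ha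
    exact ⟨nu, hnu, _, (mem_MCE_iff.1 hm).2⟩
  · rintro ⟨nu, hnu, tau, hm, hn⟩
    obtain ⟨lam, hl, _⟩ := exists_MCE_isPrefix hm hn
    obtain ⟨a, ha, rfl⟩ := (mem_MCE_iff.1 hl).2.1
    exact ⟨a, mem_Ext_iff.2 ⟨ha, nu, hnu, hl⟩⟩

theorem exhaustive_iff {v : Λ.Path} {E : Set Λ.Path} :
    Λ.Exhaustive v E ↔ ∀ lam, Λ.r lam = v →
      ∃ nu ∈ E, ∃ tau, Λ.IsPrefix lam tau ∧ Λ.IsPrefix nu tau :=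
  forall₂_congr fun _ _ => Ext_nonempty_iff

namespace FEat

variable {v w : Λ.Path} {E F : Set Λ.Path}

theorem nonempty (h : Λ.FEat v E) : E.Nonempty := by
  obtain ⟨nu, hnu, _⟩ := exhaustive_iff.1 h.2.2.2 v h.1.range_eq
  exact ⟨nu, hnu⟩

theorem not_isVertex (h : Λ.FEat v E) {lam : Λ.Path} (hl : lam ∈ E) : ¬ Λ.IsVertex lam :=
  fun hv => (h.2.1 lam hl).2 (hv.range_eq.symm.trans (h.2.1 lam hl).1)

theorem eq_of_subset (h : Λ.FEat v E) (h' : Λ.FEat w F) (hs : E ⊆ F) : v = w := by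
  obtain ⟨x, hx⟩ := h.nonempty
  exact (h.2.1 x hx).1.symm.trans (h'.2.1 x (hs hx)).1

theorem superset (h : Λ.FEat v E) (hs : E ⊆ F) (hf : F.Finite)
    (hF : ∀ lam ∈ F, Λ.r lam = v ∧ ¬ Λ.IsVertex lam) : Λ.FEat v F := by
  refine ⟨h.1, fun lam hl => ⟨(hF lam hl).1, fun e => (hF lam hl).2 (e ▸ h.1)⟩, hf, ?_⟩
  refine exhaustive_iff.2 fun lam hl => ?_
  obtain ⟨nu, hnu, t⟩ := exhaustive_iff.1 h.2.2.2 lam hl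
  exact ⟨nu, hs hnu, t⟩

theorem ext (hΛ : Λ.FinitelyAligned) (h : Λ.FEat v E) {mu : Λ.Path} (hmu : Λ.r mu = v)
    (hn : mu ∉ Λ.setLam E) : Λ.FEat (Λ.s mu) (Λ.Ext mu E) := by
  refine ⟨Λ.d_s mu, fun a ha => ?_, ?_, ?_⟩
  · obtain ⟨hr, nu, hnu, hm⟩ := mem_Ext_iff.1 ha
    refine ⟨hr.symm, ?_⟩
    rintro rfl
    rw [Λ.comp_source] at hm
    obtain ⟨b, hb, e⟩ := (mem_MCE_iff.1 hm).2.2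
    exact hn ⟨nu, hnu, b, hb, e⟩
  · have hfin : (⋃ nu ∈ E, Λ.MCE mu nu).Finite := h.2.2.1.biUnion fun nu _ => hΛ mu nu
    refine Set.Finite.of_finite_image (f := Λ.comp mu) (hfin.subset ?_) ?_
    · rintro _ ⟨a, ha, rfl⟩
      obtain ⟨_, nu, hnu, hm⟩ := mem_Ext_iff.1 ha
      exact Set.mem_biUnion hnu hm
    · intro a ha b hb e
      exact (factor_unique (mem_Ext_iff.1 ha).1 (mem_Ext_iff.1 hb).1 rfl e).2
  · refine exhaustive_iff.2 fun lam hl => ?_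
    obtain ⟨nu, hnu, tau, h1, h2⟩ :=
      exhaustive_iff.1 h.2.2.2 (Λ.comp mu lam) ((Λ.r_comp _ _ hl.symm).trans hmu)
    obtain ⟨sig, hs, hst⟩ := exists_MCE_isPrefix ((IsPrefix.comp_right hl.symm).trans h1) h2
    obtain ⟨a, ha, rfl⟩ := (mem_MCE_iff.1 hs).2.1
    obtain ⟨c, hc, rfl⟩ := (IsPrefix.comp_right hl.symm).trans h1
    exact ⟨a, mem_Ext_iff.2 ⟨ha, nu, hnu, hs⟩, c, h1.of_comp_left hl.symm hc,
      hst.of_comp_left ha hc⟩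

theorem image_seg (h : Λ.FEat v E) {n : Λ.Path → Fin k → ℕ}
    (hn : ∀ lam ∈ E, 0 < n lam ∧ n lam ≤ Λ.d lam) :
    Λ.FEat v ((fun lam => Λ.seg lam 0 (n lam)) '' E) := by
  refine ⟨h.1, ?_, h.2.2.1.image _, exhaustive_iff.2 fun lam hl => ?_⟩
  · rintro _ ⟨lam, hl, rfl⟩
    obtain ⟨h0, hle⟩ := hn lam hl
    refine ⟨(seg_zero_isPrefix hle).r_eq.trans (h.2.1 lam hl).1, fun e => h0.ne ?_⟩
    exact (h.1.symm.trans (congrArg Λ.d e.symm)).trans (d_seg_zero hle)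
  · obtain ⟨nu, hnu, tau, h1, h2⟩ := exhaustive_iff.1 h.2.2.2 lam hl
    exact ⟨_, ⟨nu, hnu, rfl⟩, tau, h1, (seg_zero_isPrefix (hn nu hnu).2).trans h2⟩

theorem substitute (h : Λ.FEat v E) (hs : F ⊆ E) {Fl : Λ.Path → Set Λ.Path}
    (hF : ∀ lam ∈ F, Λ.FEat (Λ.s lam) (Fl lam)) :
    Λ.FEat v ((E \ F) ∪ ⋃ lam ∈ F, Λ.lamSet lam (Fl lam)) := by
  refine ⟨h.1, ?_, ?_, exhaustive_iff.2 fun lam hl => ?_⟩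
  · rintro x (hx | hx)
    · exact h.2.1 x hx.1
    · simp only [Set.mem_iUnion] at hx
      obtain ⟨lam, hl, g, hg, hc, rfl⟩ := hx
      have hp := IsPrefix.comp_right hc
      refine ⟨hp.r_eq.symm.trans (h.2.1 lam (hs hl)).1,
        fun e => h.not_isVertex (hs hl) ?_⟩
      have hd := hp.d_le
      rw [e, show Λ.d v = 0 from h.1] at hd
      exact le_antisymm hd (fun i => Nat.zero_le _)
  · refine (h.2.2.1.subset Set.sdiff_subset).union
      ((h.2.2.1.subset hs).biUnion fun lam hl => ?_)
    refine ((hF lam hl).2.2.1.image (Λ.comp lam)).subset ?_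
    rintro _ ⟨g, hg, _, rfl⟩
    exact ⟨g, hg, rfl⟩
  · obtain ⟨nu, hnu, tau, h1, b, hb, rfl⟩ := exhaustive_iff.1 h.2.2.2 lam hl
    by_cases hnF : nu ∈ F
    · obtain ⟨g, hg, sig, hbs, hgs⟩ := exhaustive_iff.1 (hF nu hnF).2.2.2 b hb.symm
      have hng : Λ.s nu = Λ.r g := ((hF nu hnF).2.1 g hg).1.symm
      exact ⟨Λ.comp nu g, Or.inr (Set.mem_biUnion hnF ⟨g, hg, hng, rfl⟩), Λ.comp nu sig,
        h1.trans (hbs.comp_left hb), hgs.comp_left hng⟩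
    · exact ⟨nu, Or.inl ⟨hnu, hnF⟩, _, h1, IsPrefix.comp_right hb⟩

theorem ext_self (h : Λ.FEat v E) : Λ.Ext v E = E := by
  have hMCE : ∀ nu ∈ E, ∀ lam, lam ∈ Λ.MCE v nu ↔ lam = nu := by
    intro nu hnu lam
    have hsup : Λ.d v ⊔ Λ.d nu = Λ.d nu := by
      rw [show Λ.d v = 0 from h.1]
      exact sup_eq_right.2 fun i => Nat.zero_le _
    rw [mem_MCE_iff, hsup]
    constructor
    · rintro ⟨hd, -, hp⟩
      exact (IsPrefix.refl lam).eq_of_d_eq hp hd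
    · rintro rfl
      refine ⟨rfl, ⟨lam, ?_, ?_⟩, IsPrefix.refl lam⟩
      · rw [h.1.source_eq, (h.2.1 lam hnu).1]
      · rw [← (h.2.1 lam hnu).1, Λ.range_comp]
  ext a
  rw [mem_Ext_iff, h.1.source_eq]
  constructor
  · rintro ⟨hr, nu, hnu, hm⟩
    rw [hMCE nu hnu, hr, Λ.range_comp] at hm
    exact hm ▸ hnu
  · intro ha
    have hr := (h.2.1 a ha).1
    refine ⟨hr.symm, a, ha, (hMCE a ha _).2 ?_⟩
    rw [← hr, Λ.range_comp]

theorem notMem_setLam (h : Λ.FEat v E) : v ∉ Λ.setLam E := by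
  rintro ⟨lam, hl, mu, hc, e⟩
  have hd := (IsPrefix.comp_right hc).d_le
  rw [e, show Λ.d v = 0 from h.1] at hd
  exact h.not_isVertex hl (le_antisymm hd fun i => Nat.zero_le _)

end FEat

section Operators

variable {X Y T : Set (Set Λ.Path)}

theorem Sig2_mono (h : X ⊆ Y) : Λ.Sig2 X ⊆ Λ.Sig2 Y := by
  rintro F ⟨E, hE, hF⟩
  exact ⟨E, h hE, hF⟩

theorem Sig3_mono (h : X ⊆ Y) : Λ.Sig3 X ⊆ Λ.Sig3 Y := by
  rintro F ⟨E, hE, hF⟩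
  exact ⟨E, h hE, hF⟩

theorem Sig4_mono (h : X ⊆ Y) : Λ.Sig4 X ⊆ Λ.Sig4 Y := by
  rintro G ⟨E, hE, F, hF, Fl, hFl, rfl⟩
  exact ⟨E, h hE, F, hF, Fl, fun lam hl => ⟨h (hFl lam hl).1, (hFl lam hl).2⟩, rfl⟩

theorem subset_Sig1 (hX : X ⊆ Λ.FE) : X ⊆ Λ.Sig1 X := by
  intro E hE
  obtain ⟨v, hv⟩ := hX hE
  exact ⟨E, hE, v, hv, subset_rfl, hv.2.2.1,
    fun lam hl => ⟨(hv.2.1 lam hl).1, hv.not_isVertex hl⟩⟩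

theorem subset_Sig2 (hX : X ⊆ Λ.FE) : X ⊆ Λ.Sig2 X := by
  intro E hE
  obtain ⟨v, hv⟩ := hX hE
  exact ⟨E, hE, v, hv, v, hv.1.range_eq, hv.notMem_setLam, hv.ext_self.symm⟩

theorem subset_Sig3 (hX : X ⊆ Λ.FE) : X ⊆ Λ.Sig3 X := by
  intro E hE
  obtain ⟨v, hv⟩ := hX hE
  refine ⟨E, hE, Λ.d, fun lam hl => ⟨?_, le_rfl⟩, ?_⟩
  · exact lt_of_le_of_ne (fun i => Nat.zero_le _) fun e => hv.not_isVertex hl e.symm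
  · have hseg : (fun lam : Λ.Path => Λ.seg lam 0 (Λ.d lam)) = id := by
      funext lam
      exact (seg_zero_eq_iff le_rfl).2 (IsPrefix.refl lam)
    rw [hseg, Set.image_id]

theorem subset_Sig4 : X ⊆ Λ.Sig4 X := by
  intro E hE
  exact ⟨E, hE, ∅, Set.empty_subset _, fun _ => ∅, by simp, by simp⟩

theorem Sig1_subset_FE : Λ.Sig1 X ⊆ Λ.FE := by
  rintro F ⟨E, -, v, hv, hs, hf, hF⟩
  exact ⟨v, hv.superset hs hf hF⟩

theorem Sig2_subset_FE (hΛ : Λ.FinitelyAligned) : Λ.Sig2 X ⊆ Λ.FE := by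
  rintro F ⟨E, -, v, hv, mu, hmu, hn, rfl⟩
  exact ⟨_, hv.ext hΛ hmu hn⟩

theorem Sig3_subset_FE (hX : X ⊆ Λ.FE) : Λ.Sig3 X ⊆ Λ.FE := by
  rintro F ⟨E, hE, n, hn, rfl⟩
  obtain ⟨v, hv⟩ := hX hE
  exact ⟨v, hv.image_seg hn⟩

theorem Sig4_subset_FE (hX : X ⊆ Λ.FE) : Λ.Sig4 X ⊆ Λ.FE := by
  rintro G ⟨E, hE, F, hF, Fl, hFl, rfl⟩
  obtain ⟨v, hv⟩ := hX hE
  exact ⟨v, hv.substitute hF fun lam hl => (hFl lam hl).2⟩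

theorem Sig321_subset_FE (hΛ : Λ.FinitelyAligned) : Λ.Sig3 (Λ.Sig2 (Λ.Sig1 X)) ⊆ Λ.FE :=
  Sig3_subset_FE (Sig2_subset_FE hΛ)

theorem SigmaStep_subset_FE (hΛ : Λ.FinitelyAligned) : Λ.SigmaStep X ⊆ Λ.FE :=
  Sig4_subset_FE (Sig321_subset_FE hΛ)

theorem Sig3_subset_SigmaStep (hX : X ⊆ Λ.FE) : Λ.Sig3 X ⊆ Λ.SigmaStep X :=
  (Sig3_mono ((subset_Sig1 hX).trans (subset_Sig2 Sig1_subset_FE))).trans subset_Sig4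

theorem Sig2_subset_SigmaStep (hΛ : Λ.FinitelyAligned) (hX : X ⊆ Λ.FE) :
    Λ.Sig2 X ⊆ Λ.SigmaStep X :=
  (Sig2_mono (subset_Sig1 hX)).trans ((subset_Sig3 (Sig2_subset_FE hΛ)).trans subset_Sig4)

theorem Sig1_subset_SigmaStep (hΛ : Λ.FinitelyAligned) : Λ.Sig1 X ⊆ Λ.SigmaStep X :=
  (subset_Sig2 Sig1_subset_FE).trans ((subset_Sig3 (Sig2_subset_FE hΛ)).trans subset_Sig4)

theorem Sig4_subset_SigmaStep (hΛ : Λ.FinitelyAligned) (hX : X ⊆ Λ.FE) :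
    Λ.Sig4 X ⊆ Λ.SigmaStep X :=
  Sig4_mono ((subset_Sig1 hX).trans
    ((subset_Sig2 Sig1_subset_FE).trans (subset_Sig3 (Sig2_subset_FE hΛ))))

theorem Satiated.SigmaStep_subset (hT : Λ.Satiated T) (h : X ⊆ T) : Λ.SigmaStep X ⊆ T := by
  obtain ⟨-, S1, S2, S3, S4⟩ := hT
  have h1 : Λ.Sig1 X ⊆ T := by
    intro F hF
    have hFE := Sig1_subset_FE hF
    obtain ⟨E, hE, _, _, hs, _⟩ := hF
    exact S1 E (h hE) F hFE hs
  have h2 : Λ.Sig2 (Λ.Sig1 X) ⊆ T := by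
    rintro F ⟨E, hE, v, hv, mu, hmu, hn, rfl⟩
    exact S2 E (h1 hE) v hv mu hmu hn
  have h3 : Λ.Sig3 (Λ.Sig2 (Λ.Sig1 X)) ⊆ T := by
    rintro F ⟨E, hE, n, hn, rfl⟩
    exact S3 E (h2 hE) n hn
  rintro G ⟨E, hE, F, hF, Fl, hFl, rfl⟩
  exact S4 E (h3 hE) F hF Fl fun lam hl => ⟨h3 (hFl lam hl).1, (hFl lam hl).2⟩

theorem iterate_SigmaStep_subset_FE (hΛ : Λ.FinitelyAligned) (hX : X ⊆ Λ.FE) (n : ℕ) :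
    Λ.SigmaStep^[n] X ⊆ Λ.FE := by
  cases n with
  | zero => exact hX
  | succ n =>
    rw [Function.iterate_succ_apply']
    exact SigmaStep_subset_FE hΛ

theorem monotone_iterate_SigmaStep (hΛ : Λ.FinitelyAligned) (hX : X ⊆ Λ.FE) :
    Monotone fun n => Λ.SigmaStep^[n] X := by
  refine monotone_nat_of_le_succ fun n => ?_
  have hn := iterate_SigmaStep_subset_FE hΛ hX n
  rw [Function.iterate_succ_apply']
  exact (subset_Sig1 hn).trans (Sig1_subset_SigmaStep hΛ)

theorem mem_SigmaInf {F : Set Λ.Path} (n : ℕ) (h : F ∈ Λ.SigmaStep (Λ.SigmaStep^[n] X)) :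
    F ∈ Λ.SigmaInf X :=
  Set.mem_iUnion.2 ⟨n, by rwa [Function.iterate_succ_apply']⟩

theorem exists_of_mem_SigmaInf {F : Set Λ.Path} (h : F ∈ Λ.SigmaInf X) :
    ∃ n, F ∈ Λ.SigmaStep^[n] X :=
  (Set.mem_iUnion.1 h).imp' (· + 1) fun _ => id

theorem subset_SigmaInf (hΛ : Λ.FinitelyAligned) (hX : X ⊆ Λ.FE) : X ⊆ Λ.SigmaInf X :=
  fun _ hE => mem_SigmaInf 0 (Sig1_subset_SigmaStep hΛ (subset_Sig1 hX hE))

theorem Satiated.SigmaInf_subset (hT : Λ.Satiated T) (h : X ⊆ T) : Λ.SigmaInf X ⊆ T := by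
  have hn : ∀ n, Λ.SigmaStep^[n] X ⊆ T := by
    intro n
    induction n with
    | zero => exact h
    | succ n ih =>
      rw [Function.iterate_succ_apply']
      exact hT.SigmaStep_subset ih
  exact Set.iUnion_subset fun n => hn (n + 1)

theorem satiated_SigmaInf (hΛ : Λ.FinitelyAligned) (hX : X ⊆ Λ.FE) :
    Λ.Satiated (Λ.SigmaInf X) := by
  have hFE := iterate_SigmaStep_subset_FE hΛ hX
  refine ⟨Set.iUnion_subset fun n => hFE (n + 1), ?_, ?_, ?_, ?_⟩
  · rintro G hG E ⟨v, hv⟩ hs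
    obtain ⟨n, hn⟩ := exists_of_mem_SigmaInf hG
    obtain ⟨w, hw⟩ := hFE n hn
    obtain rfl := hw.eq_of_subset hv hs
    exact mem_SigmaInf n (Sig1_subset_SigmaStep hΛ ⟨G, hn, w, hw, hs, hv.2.2.1,
      fun lam hl => ⟨(hv.2.1 lam hl).1, hv.not_isVertex hl⟩⟩)
  · intro G hG v hv mu hmu hnot
    obtain ⟨n, hn⟩ := exists_of_mem_SigmaInf hG
    exact mem_SigmaInf n (Sig2_subset_SigmaStep hΛ (hFE n)
      ⟨G, hn, v, hv, mu, hmu, hnot, rfl⟩)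
  · intro G hG m hm
    obtain ⟨n, hn⟩ := exists_of_mem_SigmaInf hG
    exact mem_SigmaInf n (Sig3_subset_SigmaStep (hFE n) ⟨G, hn, m, hm, rfl⟩)
  · intro G hG G' hs Gl hGl
    have hmono := monotone_iterate_SigmaStep hΛ hX
    obtain ⟨n, hn⟩ := exists_of_mem_SigmaInf hG
    obtain ⟨v, hv⟩ := hFE n hn
    choose! N hN using fun lam hl => exists_of_mem_SigmaInf (hGl lam hl).1
    obtain ⟨M, hM⟩ := ((hv.2.2.1.subset hs).image N).bddAbove
    refine mem_SigmaInf (max n M) (Sig4_subset_SigmaStep hΛ (hFE _)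
      ⟨G, hmono (le_max_left n M) hn, G', hs, Gl, fun lam hl => ⟨?_, (hGl lam hl).2⟩, rfl⟩)
    exact hmono ((hM ⟨lam, hl, rfl⟩).trans (le_max_right n M)) (hN lam hl)

end Operators

end KGraph

/-- Proposition 5.5: `Σ^∞(𝓔)` is the satiation of `𝓔`. -/
theorem statement12 {k : ℕ} (Λ : KGraph k) (hΛ : Λ.FinitelyAligned)
    (𝓔 : Set (Set Λ.Path)) (h𝓔 : 𝓔 ⊆ Λ.FE) :
    Λ.SigmaInf 𝓔 = Λ.satiation 𝓔 := by
  apply Set.Subset.antisymm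
  · exact Set.subset_sInter fun T hT => hT.2.SigmaInf_subset hT.1
  · exact Set.sInter_subset_of_mem
      ⟨KGraph.subset_SigmaInf hΛ h𝓔, KGraph.satiated_SigmaInf hΛ h𝓔⟩
end

section
/- Let Λ be a finitely aligned k-graph, let 𝓔 ⊆ FE(Λ) be satiated, and suppose F ∈ FE(Λ) \ 𝓔. Let x ∈ r(F)∂(Λ;𝓔) \ F∂(Λ;𝓔), and let n ∈ ℕ^k with n ≤ d(x). Then Ext(x(0,n); F) ∈ FE(Λ) \ 𝓔. -/
open scoped ENNReal

attribute [local instance] Classical.propDecidable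

namespace KGraph

variable {k : ℕ} {Λ : KGraph k}

/-- Factorisations are unique once the degree of the first factor is fixed. -/
lemma comp_cancel {mu mu' a a' : Λ.Path} (h : Λ.s mu = Λ.r a) (h' : Λ.s mu' = Λ.r a')
    (hd : Λ.d mu = Λ.d mu') (hc : Λ.comp mu a = Λ.comp mu' a') : mu = mu' ∧ a = a' := by
  have hda : Λ.d a' = Λ.d a := by
    have := congrArg Λ.d hc
    rw [Λ.d_comp _ _ h, Λ.d_comp _ _ h', hd] at this
    exact (add_left_cancel this).symm
  have := (Λ.factor (Λ.comp mu a) (Λ.d mu) (Λ.d a) (Λ.d_comp _ _ h)).unique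
    (y₁ := (mu, a)) (y₂ := (mu', a')) ⟨h, rfl, rfl, rfl⟩ ⟨h', hd.symm, hda, hc.symm⟩
  exact Prod.ext_iff.mp this

lemma exists_comp_eq {lam : Λ.Path} {m : Fin k → ℕ} (h : m ≤ Λ.d lam) :
    ∃ mu a, Λ.s mu = Λ.r a ∧ Λ.d mu = m ∧ Λ.comp mu a = lam := by
  obtain ⟨p, ⟨h1, h2, -, h4⟩, -⟩ :=
    Λ.factor lam m (Λ.d lam - m) (add_tsub_cancel_of_le h).symm
  exact ⟨p.1, p.2, h1, h2, h4⟩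

lemma IsVertex.s_eq {q : Λ.Path} (hq : Λ.IsVertex q) : Λ.s q = q :=
  (comp_cancel (Λ.s_r q) (Λ.r_s q).symm ((Λ.d_r q).trans hq.symm)
    ((Λ.range_comp q).trans (Λ.comp_source q).symm)).2.symm

lemma split_comp {mu a : Λ.Path} (h : Λ.s mu = Λ.r a) :
    Λ.split (Λ.comp mu a) (Λ.d mu) = (mu, a) := by
  have hle : Λ.d mu ≤ Λ.d (Λ.comp mu a) := by
    rw [Λ.d_comp _ _ h]
    exact le_self_add
  rw [split, dif_pos hle]
  generalize_proofs pf
  obtain ⟨h1, h2, -, h4⟩ := pf.choose_spec.1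
  obtain ⟨e1, e2⟩ := comp_cancel h1 h h2 h4
  exact Prod.ext e1 e2

lemma seg_zero_comp {mu a : Λ.Path} (h : Λ.s mu = Λ.r a) :
    Λ.seg (Λ.comp mu a) 0 (Λ.d mu) = mu := by
  have := split_comp (Λ.s_r mu)
  rw [Λ.range_comp, Λ.d_r] at this
  rw [seg, split_comp h, this]

lemma mem_Lmin_iff {mu nu a b : Λ.Path} : (a, b) ∈ Λ.Lmin mu nu ↔
    Λ.s mu = Λ.r a ∧ Λ.s nu = Λ.r b ∧ Λ.comp mu a = Λ.comp nu b ∧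
      Λ.d mu + Λ.d a = Λ.d mu ⊔ Λ.d nu := by
  constructor
  · rintro ⟨h1, h2, h3, h4, -⟩
    exact ⟨h1, h2, h3, (Λ.d_comp _ _ h1).symm.trans h4⟩
  · rintro ⟨h1, h2, h3, h4⟩
    exact ⟨h1, h2, h3, (Λ.d_comp _ _ h1).trans h4, seg_zero_comp h1,
      (congrArg (fun z => Λ.seg z 0 (Λ.d nu)) h3).trans (seg_zero_comp h2)⟩

lemma FinitelyAligned.finite_ext (hΛ : Λ.FinitelyAligned) {E : Set Λ.Path} (hE : E.Finite)
    (mu : Λ.Path) : (Λ.Ext mu E).Finite := by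
  refine Set.Finite.of_finite_image (f := Λ.comp mu)
    ((hE.biUnion fun nu _ => hΛ mu nu).subset ?_) ?_
  · rintro _ ⟨a, ⟨-, nu, hnu, b, hab⟩, rfl⟩
    exact Set.mem_biUnion hnu hab.2.2.2
  · intro a ha a' ha' h
    exact (comp_cancel ha.1.symm ha'.1.symm rfl h).2

lemma Exhaustive.ext {v : Λ.Path} {E : Set Λ.Path} (hE : Λ.Exhaustive v E) {mu : Λ.Path}
    (hmu : Λ.r mu = v) : Λ.Exhaustive (Λ.s mu) (Λ.Ext mu E) := by
  intro lam hlam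
  obtain ⟨a, -, nu, hnu, b, hab⟩ :=
    hE (Λ.comp mu lam) ((Λ.r_comp _ _ hlam.symm).trans hmu)
  obtain ⟨h1, h2, h3, h4⟩ := mem_Lmin_iff.mp hab
  rw [Λ.s_comp _ _ hlam.symm] at h1
  rw [Λ.comp_assoc _ _ _ hlam.symm h1] at h3
  rw [Λ.d_comp _ _ hlam.symm] at h4
  have hla : Λ.s mu = Λ.r (Λ.comp lam a) := (hlam.symm).trans (Λ.r_comp _ _ h1).symm
  have hdz : Λ.d (Λ.comp mu (Λ.comp lam a)) = (Λ.d mu + Λ.d lam) ⊔ Λ.d nu := by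
    rw [Λ.d_comp _ _ hla, Λ.d_comp _ _ h1, ← add_assoc, h4]
  obtain ⟨w, t, hwt, hdw, hw⟩ := exists_comp_eq (lam := Λ.comp mu (Λ.comp lam a))
    (m := Λ.d mu ⊔ Λ.d nu) (hdz ▸ sup_le_sup_right le_self_add _)
  obtain ⟨mu', α, hmα, hdm, hα⟩ :=
    exists_comp_eq (lam := w) (m := Λ.d mu) (hdw ▸ le_sup_left)
  obtain ⟨nu', β, hnβ, hdn, hβ⟩ :=
    exists_comp_eq (lam := w) (m := Λ.d nu) (hdw ▸ le_sup_right)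
  have hαt : Λ.s α = Λ.r t := by rw [← hwt, ← hα, Λ.s_comp _ _ hmα]
  have hβt : Λ.s β = Λ.r t := by rw [← hwt, ← hβ, Λ.s_comp _ _ hnβ]
  obtain ⟨rfl, hαla⟩ := comp_cancel (hmα.trans (Λ.r_comp _ _ hαt).symm) hla hdm
    (by rw [← Λ.comp_assoc _ _ _ hmα hαt, hα, hw])
  obtain ⟨rfl, -⟩ := comp_cancel (hnβ.trans (Λ.r_comp _ _ hβt).symm) h2 hdn
    (by rw [← Λ.comp_assoc _ _ _ hnβ hβt, hβ, hw, h3])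
  have hdα : Λ.d mu' + Λ.d α = Λ.d mu' ⊔ Λ.d nu' := by rw [← Λ.d_comp _ _ hmα, hα, hdw]
  refine ⟨a, h1.symm, α, ⟨hmα.symm, nu', hnu, β,
    mem_Lmin_iff.mpr ⟨hmα, hnβ, hα.trans hβ.symm, hdα⟩⟩, t,
    mem_Lmin_iff.mpr ⟨h1, hαt, hαla.symm, ?_⟩⟩
  funext i
  have e1 := congrFun h4 i
  have e2 := congrFun hdα i
  simp only [Pi.add_apply, Pi.sup_apply] at e1 e2 ⊢
  omega

end KGraph

namespace GMor

variable {k : ℕ} {Λ : KGraph k}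

lemma isVertex_seg_self (x : GMor Λ) {n : Fin k → ℕ} (hn : ∀ i, (n i : ℕ∞) ≤ x.len i) :
    Λ.IsVertex (x.seg n n) :=
  (x.d_seg n n le_rfl hn).trans (tsub_self n)

lemma d_seg_zero (x : GMor Λ) {n : Fin k → ℕ} (hn : ∀ i, (n i : ℕ∞) ≤ x.len i) :
    Λ.d (x.seg 0 n) = n :=
  (x.d_seg 0 n zero_le hn).trans (tsub_zero n)

/-- If `x` follows `x(0,n)` by an extension of `x(0,n)` relative to `F`, then `x` has an
initial segment in `F`. -/
lemma hasInit_of_mem_ext (x : GMor Λ) {F : Set Λ.Path} {n : Fin k → ℕ}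
    {a : Λ.Path} (ha : a ∈ Λ.Ext (x.seg 0 n) F)
    (hna : ∀ i, ((n + Λ.d a) i : ℕ∞) ≤ x.len i) (hxa : x.seg n (n + Λ.d a) = a) :
    x.HasInit F := by
  obtain ⟨-, nu, hnu, b, hab⟩ := ha
  obtain ⟨-, h2, h3, h4⟩ := KGraph.mem_Lmin_iff.mp hab
  have hn : ∀ i, (n i : ℕ∞) ≤ x.len i := fun i =>
    (Nat.cast_le.mpr (Nat.le_add_right (n i) (Λ.d a i))).trans (hna i)
  rw [x.d_seg_zero hn] at h4
  have hle : Λ.d nu ≤ n + Λ.d a := h4 ▸ le_sup_right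
  have hnul : ∀ i, (Λ.d nu i : ℕ∞) ≤ x.len i := fun i =>
    (Nat.cast_le.mpr (hle i)).trans (hna i)
  refine ⟨nu, hnu, hnul, ?_⟩
  have hz : Λ.comp (x.seg 0 n) a = x.seg 0 (n + Λ.d a) := by
    conv_lhs => rw [← hxa]
    exact x.comp_seg _ _ _ zero_le le_self_add hna
  refine (KGraph.comp_cancel ?_ h2 (x.d_seg_zero hnul)
    ((x.comp_seg _ _ _ zero_le hle hna).trans (hz.symm.trans h3))).1
  rw [x.s_seg _ _ zero_le hnul, x.r_seg _ _ hle hna]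

end GMor

/-- Lemma 6.4: if `F ∈ FE(Λ) \ 𝓔`, `x ∈ r(F)∂(Λ;𝓔) \ F∂(Λ;𝓔)` and
`n ≤ d(x)`, then `Ext(x(0,n); F) ∈ FE(Λ) \ 𝓔`. -/
theorem statement15 {k : ℕ} (Λ : KGraph k) (hΛ : Λ.FinitelyAligned)
    (𝓔 : Set (Set Λ.Path)) (h𝓔 : Λ.Satiated 𝓔)
    (v : Λ.Path) (F : Set Λ.Path) (hF : Λ.FEat v F) (hFne : F ∉ 𝓔)
    (x : GMor Λ) (hx : Λ.IsBdry 𝓔 x) (hxr : x.range = v) (hxF : ¬ x.HasInit F)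
    (n : Fin k → ℕ) (hn : ∀ i, (n i : ℕ∞) ≤ x.len i) :
    Λ.Ext (x.seg 0 n) F ∈ Λ.FE ∧ Λ.Ext (x.seg 0 n) F ∉ 𝓔 := by
  have hs : Λ.s (x.seg 0 n) = x.seg n n := x.s_seg 0 n zero_le hn
  have hr : Λ.r (x.seg 0 n) = v := (x.r_seg 0 n zero_le hn).trans hxr
  have hExt : Λ.FEat (x.seg n n) (Λ.Ext (x.seg 0 n) F) := by
    refine ⟨x.isVertex_seg_self hn, fun a ha => ⟨ha.1.trans hs, ?_⟩,
      hΛ.finite_ext hF.2.2.1 _, hs ▸ hF.2.2.2.ext hr⟩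
    rintro rfl
    have hd : Λ.d (x.seg n n) = 0 := x.isVertex_seg_self hn
    exact hxF (x.hasInit_of_mem_ext ha (by rwa [hd, add_zero]) (by rw [hd, add_zero]))
  refine ⟨⟨_, hExt⟩, fun hmem => ?_⟩
  obtain ⟨a, ha, hna, hxa⟩ := hx n hn _ hmem hExt
  exact hxF (x.hasInit_of_mem_ext ha hna hxa)
end
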